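/- Let $n \geq 2$ be an integer, let $a_1 < b_1 < a_2 < b_2$ be real numbers, and let $f_1 : [a_1,b_1] \to \mathbb{R}$, $f_2 : [a_2,b_2] \to \mathbb{R}$ be smooth functions such that for $i = 1,2$: (a) $f_i > 0$, $f_i' > 0$ and $f_i'' > 0$ on $[a_i,b_i]$; (b) $(n-1)(1 - f_i'(s)^2) - 2 f_i(s) f_i''(s) > 0$ for all $s \in [a_i,b_i]$; (c) $f_1(b_1) < f_2(a_2)$ and $f_1'(b_1) = f_2'(a_2)$; and (d) $(a_2 - b_1) f_1'(b_1) = f_2(a_2) - f_1(b_1)$. Then there exists a smooth function $f : [a_1,b_2] \to \mathbb{R}$ such that: (A) $f > 0$ and $f' > 0$ on $[a_1,b_2]$; (B) $f \equiv f_1$ on $[a_1, (a_1+b_1)/2]$ and $f \equiv f_2$ on $[(a_2+b_2)/2, b_2]$; and (C) $(n-1)(1 - f'(s)^2) - 2 f(s) f''(s) > 0$ for all $s \in [a_1,b_2]$. -/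

import Mathlib

open Set

/-- Every value near the compact family of jets `(f s, g s, t * h s)`, `t ∈ [0, 1]`, still has
positive profile, positive slope and positive scalar curvature. -/
theorem exists_margin_scalar_pos (N : ℝ) {S : Set ℝ} (hS : IsCompact S)
    {f g h : ℝ → ℝ} (hf : ContinuousOn f S) (hg : ContinuousOn g S) (hh : ContinuousOn h S)
    (hpos : ∀ s ∈ S, 0 < f s ∧ 0 < g s ∧ 0 ≤ h s)
    (hscal : ∀ s ∈ S, 0 < N * (1 - g s ^ 2) - 2 * f s * h s) :
    ∃ ε > 0, ∀ s ∈ S, ∀ t ∈ Icc (0 : ℝ) 1, ∀ x y z : ℝ,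
      |x - f s| ≤ ε → |y - g s| ≤ ε → |z - t * h s| ≤ ε →
      0 < x ∧ 0 < y ∧ 0 < N * (1 - y ^ 2) - 2 * x * z := by
  let U : Set (ℝ × ℝ × ℝ) :=
    {p | 0 < p.1 ∧ 0 < p.2.1 ∧ 0 < N * (1 - p.2.1 ^ 2) - 2 * p.1 * p.2.2}
  have hU : IsOpen U := by
    refine IsOpen.and ?_ (IsOpen.and ?_ ?_) <;>
      exact isOpen_lt continuous_const (by fun_prop)
  let φ : ℝ × ℝ → ℝ × ℝ × ℝ := fun p => (f p.1, g p.1, p.2 * h p.1)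
  have hmaps : MapsTo (Prod.fst : ℝ × ℝ → ℝ) (S ×ˢ Icc (0 : ℝ) 1) S := fun p hp => hp.1
  have hφ : ContinuousOn φ (S ×ˢ Icc (0 : ℝ) 1) :=
    (hf.comp continuousOn_fst hmaps).prodMk ((hg.comp continuousOn_fst hmaps).prodMk
      (continuousOn_snd.mul (hh.comp continuousOn_fst hmaps)))
  have hK : IsCompact (φ '' (S ×ˢ Icc (0 : ℝ) 1)) := (hS.prod isCompact_Icc).image_of_continuousOn hφ
  have hKU : φ '' (S ×ˢ Icc (0 : ℝ) 1) ⊆ U := by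
    rintro _ ⟨⟨s, t⟩, ⟨hs, ht0, ht1⟩, rfl⟩
    obtain ⟨h1, h2, h3⟩ := hpos s hs
    have h4 := hscal s hs
    refine ⟨h1, h2, ?_⟩
    simp only [φ] at *
    have h5 : (1 - t) * (f s * h s) ≥ 0 :=
      mul_nonneg (by linarith) (mul_nonneg h1.le h3)
    nlinarith
  obtain ⟨ε, hε, hsub⟩ := hK.exists_cthickening_subset_open hU hKU
  refine ⟨ε, hε, fun s hs t ht x y z hx hy hz => ?_⟩
  have hmem : (x, y, z) ∈ U := by
    apply hsub
    refine Metric.mem_cthickening_of_dist_le _ (φ (s, t)) _ _ ⟨(s, t), ⟨hs, ht⟩, rfl⟩ ?_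
    simp only [φ, Prod.dist_eq, Real.dist_eq]
    exact max_le hx (max_le hy hz)
  exact hmem

/-- A function with a smooth second derivative on `S` is smooth on `S`. -/
theorem contDiffOn_of_hasDerivAt_hasDerivAt {W V k : ℝ → ℝ} {S : Set ℝ} (hS : UniqueDiffOn ℝ S)
    (hW : ∀ s, HasDerivAt W (V s) s) (hV : ∀ s, HasDerivAt V (k s) s)
    (hk : ContDiffOn ℝ (⊤ : ℕ∞) k S) : ContDiffOn ℝ (⊤ : ℕ∞) W S := by
  have key : ∀ {F G : ℝ → ℝ}, (∀ s, HasDerivAt F (G s) s) → ContDiffOn ℝ (⊤ : ℕ∞) G S →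
      ContDiffOn ℝ (⊤ : ℕ∞) F S := fun {F G} hF hG =>
    (contDiffOn_infty_iff_derivWithin hS).2
      ⟨fun s _ => (hF s).differentiableAt.differentiableWithinAt,
        hG.congr fun s hs => (hF s).hasDerivWithinAt.derivWithin (hS s hs)⟩
  exact key hW (key hV hk)

/-- A smooth step from `0` on `(-∞, p]` to `1` on `[q, ∞)`, with its first two derivatives. -/
theorem exists_smooth_step {p q : ℝ} (hpq : p < q) :
    ∃ ψ ψ₁ ψ₂ : ℝ → ℝ, ContDiff ℝ (⊤ : ℕ∞) ψ ∧ (∀ s, HasDerivAt ψ (ψ₁ s) s) ∧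
      (∀ s, HasDerivAt ψ₁ (ψ₂ s) s) ∧ (∀ s, ψ s ∈ Icc (0 : ℝ) 1) ∧
      (∀ s ≤ p, ψ s = 0) ∧ (∀ s, q ≤ s → ψ s = 1) ∧
      (∀ s, s < p ∨ q < s → ψ₁ s = 0 ∧ ψ₂ s = 0) ∧
      ∃ B, 0 ≤ B ∧ ∀ s ∈ Icc p q, |ψ₁ s| ≤ B ∧ |ψ₂ s| ≤ B := by
  let ψ : ℝ → ℝ := fun s => Real.smoothTransition ((s - p) / (q - p))
  have hqp : 0 < q - p := sub_pos.2 hpq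
  have hψ : ContDiff ℝ (⊤ : ℕ∞) ψ :=
    Real.smoothTransition.contDiff.comp ((contDiff_id.sub contDiff_const).div_const _)
  have hψ1 : ContDiff ℝ (⊤ : ℕ∞) (deriv ψ) := (contDiff_infty_iff_deriv.1 hψ).2
  have hψ2 : ContDiff ℝ (⊤ : ℕ∞) (deriv (deriv ψ)) := (contDiff_infty_iff_deriv.1 hψ1).2
  have h0 : ∀ s ≤ p, ψ s = 0 := fun s hs =>
    Real.smoothTransition.zero_of_nonpos (div_nonpos_of_nonpos_of_nonneg (by linarith) hqp.le)
  have h1 : ∀ s, q ≤ s → ψ s = 1 := fun s hs =>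
    Real.smoothTransition.one_of_one_le ((one_le_div hqp).2 (by linarith))
  have hconst : ∀ (s c : ℝ), ψ =ᶠ[nhds s] (fun _ => c) →
      deriv ψ s = 0 ∧ deriv (deriv ψ) s = 0 := fun s c hs =>
    ⟨by rw [hs.deriv_eq]; simp, by rw [hs.deriv.deriv_eq]; simp⟩
  obtain ⟨B₁, hB₁⟩ := isCompact_Icc.exists_bound_of_continuousOn
    (hψ1.continuous.continuousOn (s := Icc p q))
  obtain ⟨B₂, hB₂⟩ := isCompact_Icc.exists_bound_of_continuousOn
    (hψ2.continuous.continuousOn (s := Icc p q))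
  have hp : p ∈ Icc p q := left_mem_Icc.2 hpq.le
  refine ⟨ψ, deriv ψ, deriv (deriv ψ), hψ,
    fun s => ((contDiff_infty_iff_deriv.1 hψ).1 s).hasDerivAt,
    fun s => ((contDiff_infty_iff_deriv.1 hψ1).1 s).hasDerivAt,
    fun s => ⟨Real.smoothTransition.nonneg _, Real.smoothTransition.le_one _⟩, h0, h1, ?_,
    max B₁ B₂, ((norm_nonneg _).trans (hB₁ p hp)).trans (le_max_left _ _),
    fun s hs => ⟨(hB₁ s hs).trans (le_max_left _ _), (hB₂ s hs).trans (le_max_right _ _)⟩⟩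
  rintro s (hs | hs)
  · refine hconst s 0 ?_
    filter_upwards [Iio_mem_nhds hs] with x hx using h0 x (le_of_lt hx)
  · refine hconst s 1 ?_
    filter_upwards [Ioi_mem_nhds hs] with x hx using h1 x (le_of_lt hx)

/-- A function on `[a, b]` is modified near `b` so as to extend by an affine function beyond `b`;
the second derivative is only multiplied by a cutoff. -/
theorem exists_affine_extension_right {a m b ε : ℝ} (ham : a ≤ m) (hmb : m < b) (hε : 0 < ε)
    {f g h : ℝ → ℝ} (hf : ∀ s ∈ Icc a b, HasDerivWithinAt f (g s) (Icc a b) s)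
    (hg : ∀ s ∈ Icc a b, HasDerivWithinAt g (h s) (Icc a b) s)
    (hh : ContDiffOn ℝ (⊤ : ℕ∞) h (Icc a b)) :
    ∃ W V k : ℝ → ℝ, (∀ s, HasDerivAt W (V s) s) ∧ (∀ s, HasDerivAt V (k s) s) ∧
      ContDiffOn ℝ (⊤ : ℕ∞) k (Ici a) ∧ (∀ s ∈ Icc a m, W s = f s) ∧
      (∀ s ∈ Icc a b, |W s - f s| ≤ ε ∧ |V s - g s| ≤ ε ∧
        ∃ t ∈ Icc (0 : ℝ) 1, k s = t * h s) ∧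
      (∀ s, b ≤ s → k s = 0) ∧ (∀ s, b ≤ s → V s = V b) ∧
      (∀ s, b ≤ s → W s = W b + V b * (s - b)) := by
  have hab : a < b := ham.trans_lt hmb
  obtain ⟨M, hM⟩ := isCompact_Icc.exists_bound_of_continuousOn hh.continuousOn
  have hM0 : 0 ≤ M := (norm_nonneg _).trans (hM a (left_mem_Icc.2 hab.le))
  let η : ℝ := ε / ((M + 1) * (1 + (b - a)))
  have hden : 0 < (M + 1) * (1 + (b - a)) := mul_pos (by linarith) (by linarith)
  have hη : 0 < η := div_pos hε hden
  have hηε : η * ((M + 1) * (1 + (b - a))) = ε := div_mul_cancel₀ _ hden.ne'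
  let u : ℝ := max m (b - η)
  have hub : u < b := max_lt hmb (by linarith)
  have hmu : m ≤ u := le_max_left _ _
  have hau : a ≤ u := ham.trans hmu
  have huη : b - u ≤ η := by linarith [le_max_right m (b - η)]
  obtain ⟨ψ, -, -, hψ, -, -, hψI, hψ0, hψ1, -, -⟩ :=
    exists_smooth_step (show u < (u + b) / 2 by linarith)
  let π : ℝ → ℝ := fun t => max a (min t b)
  have hπ : ∀ t, π t ∈ Icc a b := fun t => ⟨le_max_left _ _, max_le hab.le (min_le_right _ _)⟩
  have hπ_eq : ∀ t ∈ Icc a b, π t = t := fun t ht => by simp [π, ht.1, ht.2]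
  let k : ℝ → ℝ := fun t => (1 - ψ t) * h (π t)
  have hk : Continuous k := (continuous_const.sub hψ.continuous).mul
    (hh.continuousOn.comp_continuous (by fun_prop) hπ)
  have hk_eq : ∀ t ∈ Icc a b, k t = (1 - ψ t) * h t := fun t ht => by simp only [k, hπ_eq t ht]
  have hk0 : ∀ t, (u + b) / 2 ≤ t → k t = 0 := fun t ht => by simp [k, hψ1 t ht]
  let V : ℝ → ℝ := fun s => g a + ∫ t in a..s, k t
  have hV : ∀ s, HasDerivAt V (k s) s := fun s =>
    (intervalIntegral.integral_hasDerivAt_right (hk.intervalIntegrable _ _)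
      (hk.stronglyMeasurableAtFilter _ _) hk.continuousAt).const_add _
  have hVc : Continuous V := continuous_iff_continuousAt.2 fun s => (hV s).continuousAt
  let W : ℝ → ℝ := fun s => f a + ∫ t in a..s, V t
  have hW : ∀ s, HasDerivAt W (V s) s := fun s =>
    (intervalIntegral.integral_hasDerivAt_right (hVc.intervalIntegrable _ _)
      (hVc.stronglyMeasurableAtFilter _ _) hVc.continuousAt).const_add _
  have hVa : V a - g a = 0 := by simp [V]
  have hWa : W a - f a = 0 := by simp [W]
  have hdV : ∀ s ∈ Icc a b, HasDerivWithinAt (fun x => V x - g x) (k s - h s) (Icc a b) s :=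
    fun s hs => (hV s).hasDerivWithinAt.sub (hg s hs)
  have hdW : ∀ s ∈ Icc a b, HasDerivWithinAt (fun x => W x - f x) (V s - g s) (Icc a b) s :=
    fun s hs => (hW s).hasDerivWithinAt.sub (hf s hs)
  have hsub : Icc a u ⊆ Icc a b := Icc_subset_Icc_right hub.le
  have hVu : ∀ s ∈ Icc a u, V s - g s = 0 := fun s hs => by
    have := (convex_Icc a u).norm_image_sub_le_of_norm_hasDerivWithin_le (C := 0)
      (fun x hx => (hdV x (hsub hx)).mono hsub)
      (fun x hx => by simp [hk_eq x (hsub hx), hψ0 x hx.2]) (left_mem_Icc.2 hau) hs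
    simpa [hVa] using this
  have hWu : ∀ s ∈ Icc a u, W s - f s = 0 := fun s hs => by
    have := (convex_Icc a u).norm_image_sub_le_of_norm_hasDerivWithin_le (C := 0)
      (fun x hx => (hdW x (hsub hx)).mono hsub)
      (fun x hx => by simp [hVu x hx]) (left_mem_Icc.2 hau) hs
    simpa [hWa] using this
  have hVerr : ∀ s ∈ Icc a b, |V s - g s| ≤ M * η := fun s hs => by
    rcases le_total s u with hsu | hsu
    · rw [hVu s ⟨hs.1, hsu⟩]; simpa using mul_nonneg hM0 hη.le
    have hsub' : Icc u b ⊆ Icc a b := Icc_subset_Icc_left hau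
    have := (convex_Icc u b).norm_image_sub_le_of_norm_hasDerivWithin_le (C := M)
      (fun x hx => (hdV x (hsub' hx)).mono hsub')
      (fun x hx => by
        rw [hk_eq x (hsub' hx), show (1 - ψ x) * h x - h x = -(ψ x * h x) by ring, norm_neg,
          norm_mul, Real.norm_of_nonneg (hψI x).1]
        exact (mul_le_of_le_one_left (norm_nonneg _) (hψI x).2).trans (hM x (hsub' hx)))
      (left_mem_Icc.2 hub.le) ⟨hsu, hs.2⟩
    rw [hVu u ⟨hau, le_rfl⟩, sub_zero, Real.norm_eq_abs, Real.norm_of_nonneg (by linarith)] at this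
    exact this.trans (mul_le_mul_of_nonneg_left (by linarith [hs.2]) hM0)
  have hWerr : ∀ s ∈ Icc a b, |W s - f s| ≤ M * η * (b - a) := fun s hs => by
    have := (convex_Icc a b).norm_image_sub_le_of_norm_hasDerivWithin_le hdW hVerr
      (left_mem_Icc.2 hab.le) hs
    rw [hWa, sub_zero, Real.norm_eq_abs, Real.norm_of_nonneg (by linarith [hs.1])] at this
    exact this.trans (mul_le_mul_of_nonneg_left (by linarith [hs.2]) (by positivity))
  have hMη : 0 ≤ M * η := by positivity
  have hηba : 0 ≤ η * (b - a) := mul_nonneg hη.le (by linarith)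
  have hMηba : 0 ≤ M * η * (b - a) := mul_nonneg hMη (by linarith)
  have hVb : ∀ s, b ≤ s → V s = V b := fun s hs => by
    have := (convex_Icc b s).norm_image_sub_le_of_norm_hasDerivWithin_le (C := 0)
      (fun x _ => (hV x).hasDerivWithinAt)
      (fun x hx => by simp [hk0 x (by linarith [hx.1])]) (left_mem_Icc.2 hs) (right_mem_Icc.2 hs)
    simpa [sub_eq_zero] using this
  refine ⟨W, V, k, hW, hV, ?_, fun s hs => sub_eq_zero.1 (hWu s ⟨hs.1, hs.2.trans hmu⟩),
    fun s hs => ⟨(hWerr s hs).trans (by nlinarith), (hVerr s hs).trans (by nlinarith),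
      1 - ψ s, ⟨by linarith [(hψI s).2], by linarith [(hψI s).1]⟩, hk_eq s hs⟩,
    fun s hs => hk0 s (by linarith), hVb, fun s hs => ?_⟩
  · intro s hs
    rcases lt_or_ge s b with hsb | hsb
    · have hnhds : Icc a b ∈ nhdsWithin s (Ici a) := by
        filter_upwards [self_mem_nhdsWithin, mem_nhdsWithin_of_mem_nhds (Iio_mem_nhds hsb)]
          with x hx hx' using ⟨hx, le_of_lt hx'⟩
      have hsm : ContDiffWithinAt ℝ (⊤ : ℕ∞) (fun t => (1 - ψ t) * h t) (Icc a b) s :=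
        (contDiff_const.sub hψ).contDiffWithinAt.mul (hh s ⟨hs, hsb.le⟩)
      exact (hsm.congr hk_eq (hk_eq s ⟨hs, hsb.le⟩)).mono_of_mem_nhdsWithin hnhds
    · have hz : k =ᶠ[nhds s] fun _ => 0 := by
        filter_upwards [Ioi_mem_nhds (show (u + b) / 2 < s by linarith)] with x hx
          using hk0 x (le_of_lt hx)
      exact (contDiffAt_const.congr_of_eventuallyEq hz).contDiffWithinAt
  · have := (convex_Icc b s).norm_image_sub_le_of_norm_hasDerivWithin_le (C := 0)
      (f := fun x => W x - V b * (x - b)) (f' := fun x => V x - V b * 1)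
      (fun x _ => ((hW x).sub (((hasDerivAt_id x).sub_const b).const_mul (V b))).hasDerivWithinAt)
      (fun x hx => by simp [hVb x hx.1]) (left_mem_Icc.2 hs) (right_mem_Icc.2 hs)
    rw [zero_mul, norm_le_zero_iff] at this
    linarith

/-- The mirror image of `exists_affine_extension_right`. -/
theorem exists_affine_extension_left {a m b ε : ℝ} (ham : a < m) (hmb : m ≤ b) (hε : 0 < ε)
    {f g h : ℝ → ℝ} (hf : ∀ s ∈ Icc a b, HasDerivWithinAt f (g s) (Icc a b) s)
    (hg : ∀ s ∈ Icc a b, HasDerivWithinAt g (h s) (Icc a b) s)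
    (hh : ContDiffOn ℝ (⊤ : ℕ∞) h (Icc a b)) :
    ∃ W V k : ℝ → ℝ, (∀ s, HasDerivAt W (V s) s) ∧ (∀ s, HasDerivAt V (k s) s) ∧
      ContDiffOn ℝ (⊤ : ℕ∞) k (Iic b) ∧ (∀ s ∈ Icc m b, W s = f s) ∧
      (∀ s ∈ Icc a b, |W s - f s| ≤ ε ∧ |V s - g s| ≤ ε ∧
        ∃ t ∈ Icc (0 : ℝ) 1, k s = t * h s) ∧
      (∀ s ≤ a, k s = 0) ∧ (∀ s ≤ a, V s = V a) ∧
      (∀ s ≤ a, W s = W a + V a * (s - a)) := by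
  have hmaps : MapsTo (fun x : ℝ => -x) (Icc (-b) (-a)) (Icc a b) := fun x hx =>
    ⟨by linarith [hx.2], by linarith [hx.1]⟩
  have hneg : ∀ {F G : ℝ → ℝ}, (∀ s ∈ Icc a b, HasDerivWithinAt F (G s) (Icc a b) s) →
      ∀ s ∈ Icc (-b) (-a), HasDerivWithinAt (fun x => F (-x)) (-G (-s)) (Icc (-b) (-a)) s :=
    fun {F G} hF s hs => by
      simpa [Function.comp_def] using
        (hF (-s) (hmaps hs)).scomp s (hasDerivAt_neg s).hasDerivWithinAt hmaps
  have hneg' : ∀ {F G : ℝ → ℝ}, (∀ s, HasDerivAt F (G s) s) →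
      ∀ s, HasDerivAt (fun x => F (-x)) (-G (-s)) s := fun {F G} hF s => by
    simpa [Function.comp_def] using (hF (-s)).scomp s (hasDerivAt_neg s)
  obtain ⟨W, V, k, hW, hV, hk, hWf, hest, hk0, hVb, hWb⟩ :=
    exists_affine_extension_right (neg_le_neg hmb) (neg_lt_neg ham) hε (hneg hf)
      (h := fun s => h (-s))
      (fun s hs => by simpa using (hneg hg s hs).fun_neg) (hh.comp contDiff_neg.contDiffOn hmaps)
  refine ⟨fun s => W (-s), fun s => -V (-s), fun s => k (-s), hneg' hW,
    fun s => by simpa using (hneg' hV s).fun_neg,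
    hk.comp contDiff_neg.contDiffOn fun x hx => mem_Ici.2 (neg_le_neg hx),
    fun s hs => by simpa using hWf (-s) ⟨neg_le_neg hs.2, neg_le_neg hs.1⟩,
    fun s hs => ?_, fun s hs => hk0 _ (neg_le_neg hs),
    fun s hs => by simp only [hVb _ (neg_le_neg hs)],
    fun s hs => by simp only [hWb _ (neg_le_neg hs)]; ring⟩
  obtain ⟨h1, h2, h3⟩ := hest (-s) ⟨neg_le_neg hs.2, neg_le_neg hs.1⟩
  simp only [neg_neg] at h1 h2 h3
  refine ⟨h1, ?_, h3⟩
  rwa [abs_sub_comm, show g s - -V (-s) = V (-s) - -g s by ring]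


/-- Higher-dimensional Gluing Lemma (Cabrera Pacheco–Miao, radial profile form):
for `n ≥ 2`, two smooth rotationally symmetric profiles on spheres `𝕊ⁿ` of positive
scalar curvature (i.e. `(n-1)(1 - f'^2) - 2 f f'' > 0`) with matching slopes and a
cone compatibility condition can be glued by a smooth profile of positive scalar
curvature agreeing with the originals near the ends. -/
theorem gluing_lemma_higher_dim (n : ℕ) (hn : 2 ≤ n)
    (a₁ b₁ a₂ b₂ : ℝ) (h₁ : a₁ < b₁) (h₂ : b₁ < a₂) (h₃ : a₂ < b₂)
    (f₁ f₂ : ℝ → ℝ)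
    (hf₁ : ContDiffOn ℝ (⊤ : ℕ∞) f₁ (Icc a₁ b₁))
    (hf₂ : ContDiffOn ℝ (⊤ : ℕ∞) f₂ (Icc a₂ b₂))
    (hpos₁ : ∀ s ∈ Icc a₁ b₁, 0 < f₁ s ∧ 0 < derivWithin f₁ (Icc a₁ b₁) s ∧
      0 < derivWithin (derivWithin f₁ (Icc a₁ b₁)) (Icc a₁ b₁) s)
    (hpos₂ : ∀ s ∈ Icc a₂ b₂, 0 < f₂ s ∧ 0 < derivWithin f₂ (Icc a₂ b₂) s ∧
      0 < derivWithin (derivWithin f₂ (Icc a₂ b₂)) (Icc a₂ b₂) s)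
    (hscal₁ : ∀ s ∈ Icc a₁ b₁,
      0 < ((n : ℝ) - 1) * (1 - (derivWithin f₁ (Icc a₁ b₁) s) ^ 2)
        - 2 * f₁ s * derivWithin (derivWithin f₁ (Icc a₁ b₁)) (Icc a₁ b₁) s)
    (hscal₂ : ∀ s ∈ Icc a₂ b₂,
      0 < ((n : ℝ) - 1) * (1 - (derivWithin f₂ (Icc a₂ b₂) s) ^ 2)
        - 2 * f₂ s * derivWithin (derivWithin f₂ (Icc a₂ b₂)) (Icc a₂ b₂) s)
    (hlt : f₁ b₁ < f₂ a₂)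
    (hder : derivWithin f₁ (Icc a₁ b₁) b₁ = derivWithin f₂ (Icc a₂ b₂) a₂)
    (hcone : (a₂ - b₁) * derivWithin f₁ (Icc a₁ b₁) b₁ = f₂ a₂ - f₁ b₁) :
    ∃ f : ℝ → ℝ, ContDiffOn ℝ (⊤ : ℕ∞) f (Icc a₁ b₂) ∧
      (∀ s ∈ Icc a₁ b₂, 0 < f s ∧ 0 < derivWithin f (Icc a₁ b₂) s) ∧
      (∀ s ∈ Icc a₁ ((a₁ + b₁) / 2), f s = f₁ s) ∧
      (∀ s ∈ Icc ((a₂ + b₂) / 2) b₂, f s = f₂ s) ∧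
      (∀ s ∈ Icc a₁ b₂,
        0 < ((n : ℝ) - 1) * (1 - (derivWithin f (Icc a₁ b₂) s) ^ 2)
          - 2 * f s * derivWithin (derivWithin f (Icc a₁ b₂)) (Icc a₁ b₂) s) := by
  have hN : (0 : ℝ) < (n : ℝ) - 1 := by
    have : (2 : ℝ) ≤ n := by exact_mod_cast hn
    linarith
  generalize (n : ℝ) - 1 = N at *
  obtain ⟨hd₁, hs₁⟩ := (contDiffOn_infty_iff_derivWithin (uniqueDiffOn_Icc h₁)).1 hf₁
  obtain ⟨hdd₁, hss₁⟩ := (contDiffOn_infty_iff_derivWithin (uniqueDiffOn_Icc h₁)).1 hs₁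
  obtain ⟨hd₂, hs₂⟩ := (contDiffOn_infty_iff_derivWithin (uniqueDiffOn_Icc h₃)).1 hf₂
  obtain ⟨hdd₂, hss₂⟩ := (contDiffOn_infty_iff_derivWithin (uniqueDiffOn_Icc h₃)).1 hs₂
  have hD₁ := fun s hs => (hd₁ s hs).hasDerivWithinAt
  have hDD₁ := fun s hs => (hdd₁ s hs).hasDerivWithinAt
  have hD₂ := fun s hs => (hd₂ s hs).hasDerivWithinAt
  have hDD₂ := fun s hs => (hdd₂ s hs).hasDerivWithinAt
  set g₁ := derivWithin f₁ (Icc a₁ b₁)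
  set k₁ := derivWithin g₁ (Icc a₁ b₁)
  set g₂ := derivWithin f₂ (Icc a₂ b₂)
  set k₂ := derivWithin g₂ (Icc a₂ b₂)
  have hb₁ : b₁ ∈ Icc a₁ b₁ := right_mem_Icc.2 h₁.le
  have ha₂ : a₂ ∈ Icc a₂ b₂ := left_mem_Icc.2 h₃.le
  obtain ⟨ε₁, hε₁, hm₁⟩ := exists_margin_scalar_pos N isCompact_Icc hf₁.continuousOn
    hs₁.continuousOn hss₁.continuousOn
    (fun s hs => ⟨(hpos₁ s hs).1, (hpos₁ s hs).2.1, (hpos₁ s hs).2.2.le⟩) hscal₁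
  obtain ⟨ε₂, hε₂, hm₂⟩ := exists_margin_scalar_pos N isCompact_Icc hf₂.continuousOn
    hs₂.continuousOn hss₂.continuousOn
    (fun s hs => ⟨(hpos₂ s hs).1, (hpos₂ s hs).2.1, (hpos₂ s hs).2.2.le⟩) hscal₂
  obtain ⟨hfb, hc, hkb⟩ := hpos₁ b₁ hb₁
  have hscb := hscal₁ b₁ hb₁
  obtain ⟨ε₃, hε₃, hm₃⟩ := exists_margin_scalar_pos N (isCompact_Icc (a := b₁) (b := a₂))
    (f := fun s => f₁ b₁ + g₁ b₁ * (s - b₁)) (g := fun _ => g₁ b₁) (h := fun _ => 0)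
    (by fun_prop) continuousOn_const continuousOn_const
    (fun s hs => ⟨by nlinarith [hs.1, mul_nonneg hc.le (sub_nonneg.2 hs.1)], hc, le_rfl⟩)
    (fun s hs => by nlinarith [mul_pos hfb hkb])
  obtain ⟨ψ, ψ₁, ψ₂, hψ, hψd, hψdd, hψI, hψ0, hψ1, hψout, B, hB0, hB⟩ := exists_smooth_step h₂
  have hℓ : 0 < a₂ - b₁ := sub_pos.2 h₂
  set ℓ := a₂ - b₁ with hℓdef
  let C : ℝ := (3 + 6 * B) * (1 + ℓ)
  have hC : 0 < C := by positivity
  obtain ⟨ε, hε, hεle₁, hεle₂, hεC⟩ : ∃ ε > 0, ε ≤ ε₁ ∧ ε ≤ ε₂ ∧ ε * C ≤ ε₃ :=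
    ⟨min ε₁ (min ε₂ (ε₃ / C)), lt_min hε₁ (lt_min hε₂ (by positivity)), min_le_left _ _,
      (min_le_right _ _).trans (min_le_left _ _),
      (le_div_iff₀ hC).1 ((min_le_right _ _).trans (min_le_right _ _))⟩
  obtain ⟨W, V, k, hW, hV, hk, hWf, hest, hk0, hVb, hWb⟩ := exists_affine_extension_right
    (show a₁ ≤ (a₁ + b₁) / 2 by linarith) (show (a₁ + b₁) / 2 < b₁ by linarith) hε hD₁ hDD₁ hss₁
  obtain ⟨X, Y, l, hX, hY, hl, hXf, hest', hl0, hYb, hXb⟩ := exists_affine_extension_left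
    (show a₂ < (a₂ + b₂) / 2 by linarith) (show (a₂ + b₂) / 2 ≤ b₂ by linarith) hε hD₂ hDD₂ hss₂
  let F : ℝ → ℝ := fun s => W s + ψ s * (X s - W s)
  let F₁ : ℝ → ℝ := fun s => V s + (ψ₁ s * (X s - W s) + ψ s * (Y s - V s))
  let F₂ : ℝ → ℝ := fun s => k s + ((ψ₂ s * (X s - W s) + ψ₁ s * (Y s - V s)) +
    (ψ₁ s * (Y s - V s) + ψ s * (l s - k s)))
  have hF : ∀ s, HasDerivAt F (F₁ s) s := fun s =>
    (hW s).add ((hψd s).mul ((hX s).sub (hW s)))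
  have hF' : ∀ s, HasDerivAt F₁ (F₂ s) s := fun s =>
    (hV s).add (((hψdd s).mul ((hX s).sub (hW s))).add ((hψd s).mul ((hY s).sub (hV s))))
  have hWs : ContDiffOn ℝ (⊤ : ℕ∞) W (Ici a₁) :=
    contDiffOn_of_hasDerivAt_hasDerivAt (uniqueDiffOn_Ici _) hW hV hk
  have hXs : ContDiffOn ℝ (⊤ : ℕ∞) X (Iic b₂) :=
    contDiffOn_of_hasDerivAt_hasDerivAt (uniqueDiffOn_Iic _) hX hY hl
  have hWs' := hWs.mono (fun _ hx => hx.1 : Icc a₁ b₂ ⊆ Ici a₁)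
  have hXs' := hXs.mono (fun _ hx => hx.2 : Icc a₁ b₂ ⊆ Iic b₂)
  have hu : UniqueDiffOn ℝ (Icc a₁ b₂) := uniqueDiffOn_Icc (by linarith)
  have hd : ∀ s ∈ Icc a₁ b₂, derivWithin F (Icc a₁ b₂) s = F₁ s := fun s hs =>
    (hF s).hasDerivWithinAt.derivWithin (hu s hs)
  have hdd : ∀ s ∈ Icc a₁ b₂, derivWithin (derivWithin F (Icc a₁ b₂)) (Icc a₁ b₂) s = F₂ s :=
    fun s hs => by
      rw [derivWithin_congr hd (hd s hs)]
      exact (hF' s).hasDerivWithinAt.derivWithin (hu s hs)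
  have hmain : ∀ s ∈ Icc a₁ b₂, 0 < F s ∧ 0 < F₁ s ∧
      0 < N * (1 - F₁ s ^ 2) - 2 * F s * F₂ s := by
    intro s hs
    rcases lt_or_ge s b₁ with hsb | hsb
    · obtain ⟨e1, e2, t, ht, e3⟩ := hest s ⟨hs.1, hsb.le⟩
      obtain ⟨z1, z2⟩ := hψout s (Or.inl hsb)
      have hF0 : F s = W s := by simp [F, hψ0 s hsb.le]
      have hF1 : F₁ s = V s := by simp [F₁, hψ0 s hsb.le, z1]
      have hF2 : F₂ s = k s := by simp [F₂, hψ0 s hsb.le, z1, z2]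
      rw [hF0, hF1, hF2]
      exact hm₁ s ⟨hs.1, hsb.le⟩ t ht _ _ _ (e1.trans hεle₁) (e2.trans hεle₁)
        (by simpa [e3] using hε₁.le)
    rcases lt_or_ge a₂ s with hsa | hsa
    · obtain ⟨e1, e2, t, ht, e3⟩ := hest' s ⟨hsa.le, hs.2⟩
      obtain ⟨z1, z2⟩ := hψout s (Or.inr hsa)
      have hF0 : F s = X s := by simp [F, hψ1 s hsa.le]
      have hF1 : F₁ s = Y s := by simp [F₁, hψ1 s hsa.le, z1]
      have hF2 : F₂ s = l s := by simp [F₂, hψ1 s hsa.le, z1, z2]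
      rw [hF0, hF1, hF2]
      exact hm₂ s ⟨hsa.le, hs.2⟩ t ht _ _ _ (e1.trans hεle₂) (e2.trans hεle₂)
        (by simpa [e3] using hε₂.le)
    obtain ⟨e1, e2, -⟩ := hest b₁ hb₁
    obtain ⟨e3, e4, -⟩ := hest' a₂ ha₂
    rw [← hder] at e4
    obtain ⟨B1, B2⟩ := hB s ⟨hsb, hsa⟩
    have hψabs : |ψ s| ≤ 1 := abs_le.2 ⟨by linarith [(hψI s).1], (hψI s).2⟩
    have hVc : |V s - g₁ b₁| ≤ ε := by rwa [hVb s hsb]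
    have hYc : |Y s - g₁ b₁| ≤ ε := by rwa [hYb s hsa]
    have hWL : |W s - (f₁ b₁ + g₁ b₁ * (s - b₁))| ≤ ε * (1 + ℓ) := by
      rw [hWb s hsb, show W b₁ + V b₁ * (s - b₁) - (f₁ b₁ + g₁ b₁ * (s - b₁)) =
        (W b₁ - f₁ b₁) + (V b₁ - g₁ b₁) * (s - b₁) by ring]
      refine (abs_add_le _ _).trans ?_
      rw [abs_mul, abs_of_nonneg (sub_nonneg.2 hsb)]
      have := mul_le_mul e2 (show s - b₁ ≤ ℓ by linarith) (by linarith) hε.le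
      linarith
    have hXL : |X s - (f₁ b₁ + g₁ b₁ * (s - b₁))| ≤ ε * (1 + ℓ) := by
      rw [hXb s hsa, show X a₂ + Y a₂ * (s - a₂) - (f₁ b₁ + g₁ b₁ * (s - b₁)) =
        (X a₂ - f₂ a₂) + (Y a₂ - g₁ b₁) * (s - a₂) by linear_combination -hcone]
      refine (abs_add_le _ _).trans ?_
      rw [abs_mul, abs_of_nonpos (show s - a₂ ≤ 0 by linarith)]
      have := mul_le_mul e4 (show -(s - a₂) ≤ ℓ by linarith) (by linarith) hε.le
      linarith
    have hXW : |X s - W s| ≤ 2 * (ε * (1 + ℓ)) := by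
      rw [abs_le] at hXL hWL ⊢; constructor <;> linarith
    have hYV : |Y s - V s| ≤ 2 * ε := by
      rw [abs_le] at hYc hVc ⊢; constructor <;> linarith
    have p0 : |ψ s * (X s - W s)| ≤ 1 * (2 * (ε * (1 + ℓ))) := by
      rw [abs_mul]; gcongr
    have p1 : |ψ₁ s * (X s - W s)| ≤ B * (2 * (ε * (1 + ℓ))) := by
      rw [abs_mul]; gcongr
    have p2 : |ψ s * (Y s - V s)| ≤ 1 * (2 * ε) := by
      rw [abs_mul]; gcongr
    have p3 : |ψ₂ s * (X s - W s)| ≤ B * (2 * (ε * (1 + ℓ))) := by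
      rw [abs_mul]; gcongr
    have p4 : |ψ₁ s * (Y s - V s)| ≤ B * (2 * ε) := by
      rw [abs_mul]; gcongr
    have q1 : 0 ≤ ε * ℓ := by positivity
    have q2 : 0 ≤ ε * B := by positivity
    have q3 : 0 ≤ ε * ℓ * B := by positivity
    have hεC' : ε * ((3 + 6 * B) * (1 + ℓ)) ≤ ε₃ := hεC
    refine hm₃ s ⟨hsb, hsa⟩ 0 ⟨le_rfl, zero_le_one⟩ _ _ _ ?_ ?_ ?_
    · calc |F s - (f₁ b₁ + g₁ b₁ * (s - b₁))|
          = |(W s - (f₁ b₁ + g₁ b₁ * (s - b₁))) + ψ s * (X s - W s)| := by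
            congr 1; simp only [F]; ring
        _ ≤ ε * (1 + ℓ) + 1 * (2 * (ε * (1 + ℓ))) :=
            (abs_add_le _ _).trans (add_le_add hWL p0)
        _ ≤ ε₃ := by linarith
    · calc |F₁ s - g₁ b₁|
          = |(V s - g₁ b₁) + (ψ₁ s * (X s - W s) + ψ s * (Y s - V s))| := by
            congr 1; simp only [F₁]; ring
        _ ≤ ε + (B * (2 * (ε * (1 + ℓ))) + 1 * (2 * ε)) :=
            (abs_add_le _ _).trans (add_le_add hVc
              ((abs_add_le _ _).trans (add_le_add p1 p2)))
        _ ≤ ε₃ := by linarith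
    · calc |F₂ s - 0 * 0|
          = |ψ₂ s * (X s - W s) + (ψ₁ s * (Y s - V s) + ψ₁ s * (Y s - V s))| := by
            congr 1; simp only [F₂, hk0 s hsb, hl0 s hsa]; ring
        _ ≤ B * (2 * (ε * (1 + ℓ))) + (B * (2 * ε) + B * (2 * ε)) :=
            (abs_add_le _ _).trans (add_le_add p3
              ((abs_add_le _ _).trans (add_le_add p4 p4)))
        _ ≤ ε₃ := by linarith
  refine ⟨F, hWs'.add (hψ.contDiffOn.mul (hXs'.sub hWs')), fun s hs => ?_, fun s hs => ?_,
    fun s hs => ?_, fun s hs => ?_⟩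
  · rw [hd s hs]
    exact ⟨(hmain s hs).1, (hmain s hs).2.1⟩
  · simp [F, hψ0 s (by linarith [hs.2]), hWf s hs]
  · simp [F, hψ1 s (by linarith [hs.1]), hXf s hs]
  · rw [hdd s hs, hd s hs]
    exact (hmain s hs).2.2
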